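/- arXiv:1504.01719 — 2 statements merged into one kernel-verified Lean document; each statement's English description precedes it below -/
import Mathlib

section
/- For each n, the map ω: Π_n → Π̃_n is a bijection, where Π̃_n = N_n ∩ S_n, and the linear map NCSym → KΠ̃ determined by M_π ↦ M_{ω(π)} is an isomorphism of algebras and coalgebras (hence of Hopf algebras) from NCSym onto the span KΠ̃ = ⊕_{n≥0} span_K{M_a : a ∈ Π̃_n} inside PFSym. -/
open scoped Classical

/-- Words on natural numbers (letters are intended to be positive integers). -/
abbrev W : Type := List ℕ

/-- `IsPF a` : the word `a` is a parking function, i.e. all its letters are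
positive and its nondecreasing rearrangement `b₁ b₂ ⋯ bₙ` satisfies `bᵢ ≤ i`. -/
def IsPF (a : W) : Prop :=
  (∀ x ∈ a, 1 ≤ x) ∧
    ∀ i, i < a.length → (a.insertionSort (· ≤ ·)).getD i 0 ≤ i + 1

/-- Split a word into the consecutive segments beginning at its
left-to-right minima (in the order in which they occur in the word). -/
def segs : W → List W
  | [] => []
  | x :: xs =>
      (x :: xs.takeWhile fun y => x ≤ y) :: segs (xs.dropWhile fun y => x ≤ y)
termination_by a => a.length
decreasing_by
  simpa using Nat.lt_succ_of_le (List.dropWhile_sublist _).length_le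

/-- The LR-decomposition `F_a` of a word `a`: the sequence of segments beginning
at the left-to-right minima, listed in increasing order of their minimal letters
(i.e. in reverse order of occurrence in `a`). -/
def LR (a : W) : List W := (segs a).reverse

/-- The word `w_k ⋯ w_2 w_1` encoded by an LR-decomposition `(w_1, …, w_k)`. -/
def wordOf (F : List W) : W := F.reverse.flatten

/-- A word is dominated if it is nonempty and its first letter is its minimal letter. -/
def Dominated (w : W) : Prop := w ≠ [] ∧ ∀ x ∈ w, w.headD 0 ≤ x

/-- The minimal letter of a word (`0` for the empty word). -/
def minW (w : W) : ℕ := (w.min?).getD 0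

/-- Add `m` to every letter of a word. -/
def shiftW (m : ℕ) (w : W) : W := w.map (· + m)

/-- Add `m` to every letter of every word of a sequence of words. -/
def shiftF (m : ℕ) (F : List W) : List W := F.map (shiftW m)

/-- The word whose LR-decomposition is the finite set of words `G`:
sort `G` increasingly (for dominated words with distinct minimal letters the
lexicographic order agrees with comparing the minimal letters) and concatenate
in decreasing order. -/
noncomputable def wordOfSet (G : Finset W) : W := (G.sort (· ≤ ·)).reverse.flatten

/-- Given vertex sets `X`, `Y` (of words) and a set `Θ` of edges, the resulting
set of words: concatenations `u ++ w` over edges `(u, w) ∈ Θ`, together with all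
unmatched words of `X` and of `Y`. -/
noncomputable def glueSet (X Y : Finset W) (Θ : Finset (W × W)) : Finset W :=
  Θ.image (fun p => p.1 ++ p.2) ∪
    X.filter (fun u => ∀ p ∈ Θ, p.1 ≠ u) ∪
    Y.filter (fun w => ∀ p ∈ Θ, p.2 ≠ w)

/-- `R(a,b)` : the set of matchings between `F_a` and `F_b + m` (`m` the length
of `a`), encoded as sets of edges in which no vertex occurs twice. -/
noncomputable def Rset (a b : W) : Finset (Finset (W × W)) :=
  ((LR a).toFinset ×ˢ (shiftF a.length (LR b)).toFinset).powerset.filter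
    (fun Θ => ∀ p ∈ Θ, ∀ q ∈ Θ, (p.1 = q.1 ∨ p.2 = q.2) → p = q)

/-- `aΘb` : the parking function whose LR-decomposition consists of the
concatenations `u ⬝ (w + m)` over the edges `(u, w + m)` of `Θ` together with all
unmatched words of `F_a` and of `F_b + m`. -/
noncomputable def mTheta (a b : W) (Θ : Finset (W × W)) : W :=
  wordOfSet (glueSet (LR a).toFinset (shiftF a.length (LR b)).toFinset Θ)

/-- `d(a) = min { i : #{ j : a_j ≤ i } < i }`. -/
def dVal (a : W) : ℕ :=
  Nat.find (p := fun i => (a.filter (fun x => x ≤ i)).length < i)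
    ⟨a.length + 1, Nat.lt_succ_of_le (List.length_filter_le _ _)⟩

/-- One step of the parkization algorithm: decrement every letter greater
than `d(a)`.  (This is the identity when `a` is a parking function.) -/
def parkStep (a : W) : W := a.map fun x => if dVal a < x then x - 1 else x

/-- Auxiliary fueled version of the parkization algorithm. -/
def parkFuel : ℕ → W → W
  | 0, a => a
  | k + 1, a => if dVal a = a.length + 1 then a else parkFuel k (parkStep a)

/-- The parkization `Park a` of a word `a`.  (For a word with positive letters
the algorithm needs at most `a.sum` steps, so the fuel below suffices.) -/
def Park (a : W) : W := parkFuel a.sum a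

/-- The subword of `a` obtained by keeping exactly the words of `F_a`
belonging to `S`. -/
def subWord (a : W) (S : Finset W) : W := wordOf ((LR a).filter (· ∈ S))

/-- The free module with basis indexed by words; the Hopf algebra `PFSym` is
its submodule spanned by `{M_a : a ∈ P}`. -/
abbrev FW (K : Type) [Field K] : Type := W →₀ K

/-- The monomial basis element `M_a`. -/
noncomputable def Mb (K : Type) [Field K] (a : W) : FW K := Finsupp.single a 1

/-- `M_a ⋆ M_b = Σ_{Θ ∈ R(a,b)} M_{aΘb}` on basis elements. -/
noncomputable def mulSingle (K : Type) [Field K] (a b : W) : FW K :=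
  ∑ Θ ∈ Rset a b, Mb K (mTheta a b Θ)

/-- The product `⋆`, extended bilinearly. -/
noncomputable def starF (K : Type) [Field K] (x y : FW K) : FW K :=
  x.sum fun a ca => y.sum fun b cb => (ca * cb) • mulSingle K a b

/-- The free module with basis indexed by pairs of words; it realizes the
tensor square of `FW K` via `M_a ⊗ M_b ↦ single (a,b)`. -/
abbrev FW2 (K : Type) [Field K] : Type := (W × W) →₀ K

/-- `Δ(M_a) = Σ M_{Park a'} ⊗ M_{Park a''}` over ordered pairs `(a', a'')` of
subwords of `a` with `F_{a'} ⊍ F_{a''} = F_a` (encoded by the subset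
`S ⊆ F_a` of words kept in `a'`). -/
noncomputable def deltaSingle (K : Type) [Field K] (a : W) : FW2 K :=
  ∑ S ∈ ((LR a).toFinset).powerset,
    Finsupp.single
      (Park (subWord a S), Park (subWord a (((LR a).toFinset) \ S))) 1

/-- The coproduct `Δ`, extended linearly. -/
noncomputable def deltaF (K : Type) [Field K] (x : FW K) : FW2 K :=
  x.sum fun a ca => ca • deltaSingle K a

/-- The componentwise product on the tensor square, on basis elements:
`(M_a ⊗ M_b) ⋆ (M_c ⊗ M_d) = (M_a ⋆ M_c) ⊗ (M_b ⋆ M_d)`. -/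
noncomputable def star2Single (K : Type) [Field K] (p q : W × W) : FW2 K :=
  ∑ Θ ∈ Rset p.1 q.1, ∑ Θ' ∈ Rset p.2 q.2,
    Finsupp.single (mTheta p.1 q.1 Θ, mTheta p.2 q.2 Θ') 1

/-- The componentwise product on the tensor square, extended bilinearly. -/
noncomputable def star2F (K : Type) [Field K] (x y : FW2 K) : FW2 K :=
  x.sum fun p cp => y.sum fun q cq => (cp * cq) • star2Single K p q

/-- The counit `ε` on basis elements. -/
noncomputable def epsW (K : Type) [Field K] (a : W) : K := if a = [] then 1 else 0

/-- `F_a ∘ F_b` : concatenate the `i`-th words of `F_a` and `F_b + m`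
for `i ≤ min(r,s)` and keep the remaining unpaired words. -/
def splitLR (F G : List W) : List W :=
  List.zipWith (· ++ ·) F G ++ F.drop G.length ++ G.drop F.length

/-- The split product `a ∘ b`. -/
def splitProd (a b : W) : W := wordOf (splitLR (LR a) (shiftF a.length (LR b)))

/-- A nonempty parking function is unsplitable if it is not the split product
of two nonempty parking functions. -/
def UnsplitablePF (a : W) : Prop :=
  IsPF a ∧ a ≠ [] ∧
    ¬ ∃ b c : W, IsPF b ∧ IsPF c ∧ b ≠ [] ∧ c ≠ [] ∧ a = splitProd b c

/-- The slash product `a | b = (b₁+m) ⋯ (bₙ+m) a₁ ⋯ a_m`. -/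
def slashProd (a b : W) : W := shiftW a.length b ++ a

/-- A nonempty parking function is atomic if it is not the slash product
of two nonempty parking functions. -/
def AtomicPF (a : W) : Prop :=
  IsPF a ∧ a ≠ [] ∧
    ¬ ∃ b c : W, IsPF b ∧ IsPF c ∧ b ≠ [] ∧ c ≠ [] ∧ a = slashProd b c

/-- `u ≺* v` : either `v` is a proper initial subword of `u`, or `u` is not a
proper initial subword of `v` and `u` precedes `v` lexicographically. -/
def precStar (u v : W) : Prop :=
  (v <+: u ∧ v ≠ u) ∨ (¬ (u <+: v ∧ u ≠ v) ∧ List.Lex (· < ·) u v)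

/-- `a ≺*_lex b` : `F_a` strictly precedes `F_b` in the lexicographic order
on sequences of words induced by `≺*`. -/
def precStarLex (a b : W) : Prop := List.Lex precStar (LR a) (LR b)

/-- The covering relation of `≤_*` : `b` covers `a` if `F_b` is obtained from
`F_a = (w_1, …, w_r)` by replacing `w_i` by `w_i ⬝ w_j` and removing `w_j`,
for some `i < j` such that every letter of `w_i` is at most every letter of `w_j`. -/
def CovStar (a b : W) : Prop :=
  ∃ i j, i < j ∧ j < (LR a).length ∧
    (∀ x ∈ (LR a).getD i [], ∀ y ∈ (LR a).getD j [], x ≤ y) ∧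
    LR b = ((LR a).set i ((LR a).getD i [] ++ (LR a).getD j [])).eraseIdx j

/-- The partial order `≤_*` on parking functions, generated by the covering
relations. -/
def leStar (a b : W) : Prop := Relation.ReflTransGen CovStar a b

/-- The finite set of all parking functions of length `n`. -/
noncomputable def pfFinset (n : ℕ) : Finset W :=
  ((Finset.univ : Finset (Fin n → Fin n)).image
      (fun f => List.ofFn fun i => (f i).val + 1)).filter IsPF

/-- The basis element `Q_a = Σ_{a ≤_* b} M_b`. -/
noncomputable def Qb (K : Type) [Field K] (a : W) : FW K :=
  ∑ b ∈ (pfFinset a.length).filter (fun b => leStar a b), Mb K b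

/-- `Q_x ⊗ Q_y` as an element of the tensor square. -/
noncomputable def QT (K : Type) [Field K] (x y : W) : FW2 K :=
  ∑ b ∈ (pfFinset x.length).filter (fun b => leStar x b),
    ∑ c ∈ (pfFinset y.length).filter (fun c => leStar y c),
      Finsupp.single (b, c) 1

/-- `a` is a nonincreasing word. -/
def NonInc (a : W) : Prop := a.Chain' (fun x y => y ≤ x)

/-- Every word of the LR-decomposition of `a` is nondecreasing. -/
def Nprop (a : W) : Prop := ∀ w ∈ LR a, w.Chain' (· ≤ ·)

/-- The words of the LR-decomposition of `a` have pairwise disjoint sets of letters. -/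
def Dprop (a : W) : Prop := (LR a).Pairwise (fun u v => ∀ x ∈ u, x ∉ v)

/-- `a` is a permutation of `{1, …, n}` viewed as a word. -/
def Sprop (a : W) : Prop := a.Perm (List.range' 1 a.length)


/-- Blocks: finite sets of positive integers. -/
abbrev Blk : Type := Finset ℕ

/-- Set partitions, encoded as finite sets of blocks. -/
abbrev SP : Type := Finset Blk

/-- `π` is a set partition of `{1, …, n}`. -/
def IsPartitionOf (n : ℕ) (π : SP) : Prop :=
  (∀ B ∈ π, B ≠ ∅) ∧ ((π : Set Blk).Pairwise fun B C => Disjoint B C) ∧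
    π.biUnion id = Finset.Icc 1 n

/-- `σ + m` : add `m` to every element of every block of `σ`. -/
def shiftP (m : ℕ) (σ : SP) : SP := σ.image (fun B => B.image (· + m))

/-- The set of matchings between the blocks of `π` and the blocks of `τ`,
encoded as sets of edges in which no block occurs twice. -/
noncomputable def RsetP (π τ : SP) : Finset (Finset (Blk × Blk)) :=
  (π ×ˢ τ).powerset.filter
    (fun Θ => ∀ p ∈ Θ, ∀ q ∈ Θ, (p.1 = q.1 ∨ p.2 = q.2) → p = q)

/-- The partition obtained from a matching `Θ` between `π` and `τ` by merging
each matched pair of blocks and keeping all unmatched blocks. -/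
noncomputable def glueP (π τ : SP) (Θ : Finset (Blk × Blk)) : SP :=
  Θ.image (fun p => p.1 ∪ p.2) ∪
    π.filter (fun B => ∀ p ∈ Θ, p.1 ≠ B) ∪
    τ.filter (fun B => ∀ p ∈ Θ, p.2 ≠ B)

/-- The standardization of a finite family of disjoint finite sets of integers:
replace the smallest element by `1`, the second smallest by `2`, and so on. -/
def stP (τ : SP) : SP :=
  τ.image fun B => B.image fun x => ((τ.biUnion id).filter (· ≤ x)).card

/-- `ω(π) = w(B_k) ⬝ w(B_{k-1}) ⋯ w(B_1)`, the concatenation of the increasing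
arrangements of the blocks of `π`, in decreasing order of their minima. -/
noncomputable def omegaP (π : SP) : W := wordOfSet (π.image fun B => B.sort (· ≤ ·))


/-! ### Words, sorting and LR-decompositions -/

/-- Increasing arrangement of a block. -/
def swB (B : Blk) : W := B.sort (· ≤ ·)

/-- Lists of nonempty strictly increasing words with strictly increasing heads. -/
def OKL (L : List W) : Prop :=
  (∀ w ∈ L, w ≠ [] ∧ w.Pairwise (· < ·)) ∧ L.Pairwise (fun u v => u.headD 0 < v.headD 0)

/-- Families of nonempty pairwise disjoint blocks. -/
def GoodP (π : SP) : Prop :=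
  (∀ B ∈ π, B ≠ ∅) ∧ ((π : Set Blk).Pairwise fun B C => Disjoint B C)

lemma mem_swB {x : ℕ} {B : Blk} : x ∈ swB B ↔ x ∈ B := by
  simp [swB]

lemma swB_toFinset (B : Blk) : (swB B).toFinset = B := by
  ext x; simp [mem_swB]

lemma swB_inj : Function.Injective swB := fun B C h => by
  rw [← swB_toFinset B, ← swB_toFinset C, h]

lemma swB_sorted (B : Blk) : (swB B).Pairwise (· < ·) := by
  exact (Finset.sortedLT_sort B).pairwise

lemma sort_toFinset_of_lt {α : Type*} [LinearOrder α] [DecidableEq α] (l : List α)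
    (h : l.Pairwise (· < ·)) : l.toFinset.sort (· ≤ ·) = l := by
  have hn : l.Nodup := h.imp (fun h => ne_of_lt h)
  have hp : (l.toFinset.sort (· ≤ ·)).Perm l := by
    rw [List.perm_ext_iff_of_nodup (Finset.sort_nodup _ _) hn]
    intro a; simp
  refine List.Perm.eq_of_pairwise (le := (· ≤ ·)) ?_ ?_ ?_ hp
  · intro a b _ _ h1 h2; exact le_antisymm h1 h2
  · exact Finset.pairwise_sort _ _
  · exact h.imp (fun h => le_of_lt h)

lemma swB_toFinset_of_sorted (w : W) (h : w.Pairwise (· < ·)) : swB w.toFinset = w := by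
  exact sort_toFinset_of_lt w h

lemma lt_of_head {u v : W} (hu : u ≠ []) (hv : v ≠ []) (h : u.headD 0 < v.headD 0) : u < v := by
  cases u with
  | nil => exact absurd rfl hu
  | cons a u =>
    cases v with
    | nil => exact absurd rfl hv
    | cons b v => exact List.Lex.rel h

lemma head_le_of_lt {u v : W} (hu : u ≠ []) (h : u < v) : u.headD 0 ≤ v.headD 0 := by
  cases u with
  | nil => exact absurd rfl hu
  | cons a u =>
    cases v with
    | nil => exact absurd h (by simp)
    | cons b v =>
      have h' : List.Lex (· < ·) (a :: u) (b :: v) := h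
      cases h' with
      | rel h => exact le_of_lt h
      | cons h => exact le_rfl

lemma OKL.lt {L : List W} (h : OKL L) : L.Pairwise (· < ·) := by
  refine List.Pairwise.imp_of_mem ?_ h.2
  intro u v hu hv huv
  exact lt_of_head (h.1 u hu).1 (h.1 v hv).1 huv

lemma OKL.sort {L : List W} (h : OKL L) : L.toFinset.sort (· ≤ ·) = L :=
  sort_toFinset_of_lt L h.lt

lemma headD_mem {u : W} (hu : u ≠ []) : u.headD 0 ∈ u := by
  cases u with
  | nil => exact absurd rfl hu
  | cons a u => simp

lemma head_le_mem {u : W} (hs : u.Pairwise (· < ·)) {x : ℕ} (hx : x ∈ u) : u.headD 0 ≤ x := by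
  cases u with
  | nil => simp at hx
  | cons a u =>
    rw [List.pairwise_cons] at hs
    rcases List.mem_cons.1 hx with rfl | h
    · simp
    · exact le_of_lt (hs.1 x h)

lemma segs_flatten_of (M : List W) (h1 : ∀ w ∈ M, w ≠ [] ∧ w.Pairwise (· < ·))
    (h2 : M.Pairwise (fun u v => v.headD 0 < u.headD 0)) : segs M.flatten = M := by
  induction M with
  | nil => simp [segs]
  | cons w M ih =>
    have ih' := ih (fun w hw => h1 w (List.mem_cons_of_mem _ hw)) (List.pairwise_cons.1 h2).2
    obtain ⟨hw, hs⟩ := h1 w (by simp)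
    cases w with
    | nil => exact absurd rfl hw
    | cons x xs =>
      have hx : ∀ y ∈ xs, x ≤ y := fun y hy => le_of_lt ((List.pairwise_cons.1 hs).1 y hy)
      have key : ∀ y ∈ M.flatten.head?, ¬ x ≤ y := by
        cases M with
        | nil => simp
        | cons v M =>
          have hv := (h1 v (by simp)).1
          have := (List.pairwise_cons.1 h2).1 v (by simp)
          cases v with
          | nil => exact absurd rfl hv
          | cons z zs => simpa using this
      have ht : (xs ++ M.flatten).takeWhile (fun y => decide (x ≤ y)) = xs := by
        rw [List.takeWhile_append_of_pos (by simpa using hx)]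
        cases hM : M.flatten with
        | nil => simp
        | cons z zs =>
          have := key z (by simp [hM])
          simpa using this
      have hd : (xs ++ M.flatten).dropWhile (fun y => decide (x ≤ y)) = M.flatten := by
        rw [List.dropWhile_append_of_pos (by simpa using hx)]
        cases hM : M.flatten with
        | nil => simp
        | cons z zs =>
          have := key z (by simp [hM])
          simpa using this
      simp only [List.flatten_cons, List.cons_append, segs]
      rw [ht, hd, ih']

lemma OKL.LR {L : List W} (h : OKL L) : LR L.reverse.flatten = L := by
  unfold _root_.LR
  rw [segs_flatten_of, List.reverse_reverse]
  · intro w hw; exact h.1 w (by simpa using hw)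
  · rw [List.pairwise_reverse]; exact h.2

lemma segs_flatten (a : W) : (segs a).flatten = a := by
  induction a using segs.induct with
  | case1 => simp [segs]
  | case2 x xs ih =>
    rw [segs, List.flatten_cons, ih, List.cons_append, List.takeWhile_append_dropWhile]

lemma segs_ne (a : W) : ∀ w ∈ segs a, w ≠ [] := by
  induction a using segs.induct with
  | case1 => simp [segs]
  | case2 x xs ih =>
    rw [segs]
    intro w hw
    rcases List.mem_cons.1 hw with rfl | h
    · simp
    · exact ih w h

lemma segs_head (a : W) : ∀ v ∈ segs a, v.headD 0 ≤ a.headD 0 := by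
  induction a using segs.induct with
  | case1 => simp [segs]
  | case2 x xs ih =>
    rw [segs]
    intro w hw
    rcases List.mem_cons.1 hw with rfl | h
    · simp
    · refine (ih w h).trans ?_
      cases hd : xs.dropWhile (fun y => decide (x ≤ y)) with
      | nil => simp
      | cons z zs =>
        have := List.head?_dropWhile_not (fun y => decide (x ≤ y)) xs
        rw [hd] at this
        simp at this
        simpa using le_of_lt this

lemma segs_pairwise (a : W) : (segs a).Pairwise (fun u v => v.headD 0 < u.headD 0) := by
  induction a using segs.induct with
  | case1 => simp [segs]
  | case2 x xs ih =>
    rw [segs, List.pairwise_cons]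
    refine ⟨fun w h => ?_, ih⟩
    refine (segs_head _ w h).trans_lt ?_
    cases hd : xs.dropWhile (fun y => decide (x ≤ y)) with
    | nil => rw [hd] at h; simp [segs] at h
    | cons z zs =>
      have := List.head?_dropWhile_not (fun y => decide (x ≤ y)) xs
      rw [hd] at this
      simp at this
      simpa using this

/-! ### Good families and `omegaP` -/

/-- The LR list of a family of blocks. -/
noncomputable def lrP (π : SP) : List W := (π.image swB).sort (· ≤ ·)

lemma omegaP_eq (π : SP) : omegaP π = (lrP π).reverse.flatten := rfl

lemma mem_lrP {π : SP} {w : W} : w ∈ lrP π ↔ ∃ B ∈ π, swB B = w := by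
  simp [lrP]

lemma lrP_toFinset (π : SP) : (lrP π).toFinset = π.image swB := by
  simp [lrP]

lemma swB_ne {B : Blk} (h : B ≠ ∅) : swB B ≠ [] := fun h' => h (by
  rw [← swB_toFinset B, h']; rfl)

lemma GoodP.okl {π : SP} (h : GoodP π) : OKL (lrP π) := by
  have h1 : ∀ w ∈ lrP π, w ≠ [] ∧ w.Pairwise (· < ·) := by
    intro w hw
    obtain ⟨B, hB, rfl⟩ := mem_lrP.1 hw
    exact ⟨swB_ne (h.1 B hB), swB_sorted B⟩
  refine ⟨h1, ?_⟩
  have hs : (lrP π).Pairwise (· < ·) := (Finset.sortedLT_sort _).pairwise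
  refine List.Pairwise.imp_of_mem ?_ hs
  intro u v hu hv huv
  refine lt_of_le_of_ne (head_le_of_lt (h1 u hu).1 huv) ?_
  intro he
  obtain ⟨B, hB, rfl⟩ := mem_lrP.1 hu
  obtain ⟨C, hC, rfl⟩ := mem_lrP.1 hv
  have hBC : B ≠ C := by rintro rfl; exact lt_irrefl _ huv
  have hd := h.2 hB hC hBC
  have hb := mem_swB.1 (headD_mem (swB_ne (h.1 B hB)))
  have hc := mem_swB.1 (headD_mem (swB_ne (h.1 C hC)))
  rw [he] at hb
  exact Finset.disjoint_left.1 hd hb hc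

lemma GoodP.LR {π : SP} (h : GoodP π) : LR (omegaP π) = lrP π := h.okl.LR

lemma GoodP.LR_toFinset {π : SP} (h : GoodP π) : (_root_.LR (omegaP π)).toFinset = π.image swB := by
  rw [h.LR, lrP_toFinset]

lemma GoodP.inj {π σ : SP} (h : GoodP π) (h' : GoodP σ) (he : omegaP π = omegaP σ) : π = σ := by
  have := h.LR_toFinset
  rw [he, h'.LR_toFinset] at this
  exact (Finset.image_injective swB_inj this).symm

lemma mem_omegaP {π : SP} {x : ℕ} : x ∈ omegaP π ↔ ∃ B ∈ π, x ∈ B := by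
  rw [omegaP_eq]
  simp only [List.mem_flatten, List.mem_reverse, mem_lrP]
  constructor
  · rintro ⟨_, ⟨B, hB, rfl⟩, hx⟩; exact ⟨B, hB, mem_swB.1 hx⟩
  · rintro ⟨B, hB, hx⟩; exact ⟨_, ⟨B, hB, rfl⟩, mem_swB.2 hx⟩

lemma omegaP_toFinset (π : SP) : (omegaP π).toFinset = π.biUnion id := by
  ext x; simp [mem_omegaP]

lemma GoodP.nodup {π : SP} (h : GoodP π) : (omegaP π).Nodup := by
  rw [omegaP_eq, List.nodup_flatten]
  constructor
  · intro w hw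
    exact ((h.okl.1 w (by simpa using hw)).2).imp (fun h => ne_of_lt h)
  · rw [List.pairwise_reverse]
    have hs : (lrP π).Pairwise (· < ·) := (Finset.sortedLT_sort _).pairwise
    refine List.Pairwise.imp_of_mem ?_ hs
    intro u v hu hv huv
    obtain ⟨B, hB, rfl⟩ := mem_lrP.1 hu
    obtain ⟨C, hC, rfl⟩ := mem_lrP.1 hv
    have hBC : B ≠ C := by rintro rfl; exact lt_irrefl _ huv
    intro x hx hy
    exact Finset.disjoint_left.1 (h.2 hB hC hBC) (mem_swB.1 hy) (mem_swB.1 hx)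

lemma GoodP.subset {π S : SP} (h : GoodP π) (hS : S ⊆ π) : GoodP S :=
  ⟨fun B hB => h.1 B (hS hB), h.2.mono (by exact_mod_cast hS)⟩

lemma IsPartitionOf.good {n : ℕ} {π : SP} (h : IsPartitionOf n π) : GoodP π := ⟨h.1, h.2.1⟩

lemma IsPartitionOf.perm {n : ℕ} {π : SP} (h : IsPartitionOf n π) :
    (omegaP π).Perm (List.range' 1 n) := by
  rw [List.perm_ext_iff_of_nodup h.good.nodup List.nodup_range']
  intro x
  rw [← List.mem_toFinset, omegaP_toFinset, h.2.2]
  simp only [Finset.mem_Icc, List.mem_range'_1]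
  omega

lemma IsPartitionOf.length {n : ℕ} {π : SP} (h : IsPartitionOf n π) :
    (omegaP π).length = n := by
  simpa using h.perm.length_eq

lemma isPF_of_Sprop {a : W} (h : Sprop a) : IsPF a := by
  unfold Sprop at h
  constructor
  · intro x hx
    have := h.subset hx
    simp at this; omega
  · intro i hi
    have : a.insertionSort (· ≤ ·) = List.range' 1 a.length := by
      refine List.Perm.eq_of_pairwise (le := (· ≤ ·)) ?_ ?_ ?_ ((List.perm_insertionSort _ _).trans h)
      · intro a b _ _ h1 h2; exact le_antisymm h1 h2
      · exact List.pairwise_insertionSort _ _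
      · exact (List.pairwise_lt_range').imp (fun h => le_of_lt h)
    rw [this, List.getD_eq_getElem _ _ (by simpa using hi)]
    simp; omega

lemma part1 (n : ℕ) : Set.BijOn omegaP {π : SP | IsPartitionOf n π}
      {a : W | IsPF a ∧ a.length = n ∧ Nprop a ∧ Sprop a} := by
  refine ⟨?_, ?_, ?_⟩
  · intro π hπ
    have hπ : IsPartitionOf n π := hπ
    have hS : Sprop (omegaP π) := by
      unfold Sprop; rw [hπ.length]; exact hπ.perm
    refine ⟨isPF_of_Sprop hS, hπ.length, ?_, hS⟩
    intro w hw
    rw [hπ.good.LR] at hw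
    exact ((hπ.good.okl.1 w hw).2.imp (fun h => le_of_lt h)).isChain
  · intro π hπ σ hσ h
    exact IsPartitionOf.good hπ |>.inj (IsPartitionOf.good hσ) h
  · rintro a ⟨-, rfl, hN, hS⟩
    unfold Sprop at hS
    have hnd : a.Nodup := hS.nodup_iff.2 List.nodup_range'
    have hfl := segs_flatten a
    have hnd' := hnd
    rw [← hfl, List.nodup_flatten] at hnd'
    have hsort : ∀ w ∈ LR a, w.Pairwise (· < ·) := by
      intro w hw
      have h1 : w.Pairwise (· ≤ ·) := List.isChain_iff_pairwise.1 (hN w hw)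
      have h2 : w.Nodup := hnd'.1 w (by simpa [LR] using hw)
      exact (h1.and h2).imp (fun h => lt_of_le_of_ne h.1 h.2)
    have hok : OKL (LR a) := by
      refine ⟨fun w hw => ⟨segs_ne a w (by simpa [LR] using hw), hsort w hw⟩, ?_⟩
      unfold LR
      rw [List.pairwise_reverse]; exact segs_pairwise a
    have him : ((LR a).toFinset.image List.toFinset).image swB = (LR a).toFinset := by
      rw [Finset.image_image]
      ext w
      simp only [Finset.mem_image, List.mem_toFinset, Function.comp]
      constructor
      · rintro ⟨v, hv, rfl⟩; rw [swB_toFinset_of_sorted v (hsort v hv)]; exact hv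
      · intro hw; exact ⟨w, hw, swB_toFinset_of_sorted w (hsort w hw)⟩
    refine ⟨(LR a).toFinset.image List.toFinset, ⟨?_, ?_, ?_⟩, ?_⟩
    · intro B hB
      simp only [Finset.mem_image, List.mem_toFinset] at hB
      obtain ⟨w, hw, rfl⟩ := hB
      simpa using (hok.1 w hw).1
    · intro B hB C hC hBC
      simp only [Finset.coe_image, Set.mem_image, Finset.mem_coe, List.mem_toFinset] at hB hC
      obtain ⟨u, hu, rfl⟩ := hB
      obtain ⟨v, hv, rfl⟩ := hC
      have huv : u ≠ v := by rintro rfl; exact hBC rfl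
      have hsy : Std.Symm (List.Disjoint (α := ℕ)) := ⟨fun _ _ h => h.symm⟩
      have := hnd'.2.forall (by simpa [LR] using hu) (by simpa [LR] using hv) huv
      rw [Finset.disjoint_left]
      intro x hx hy
      exact this (by simpa using hx) (by simpa using hy)
    · ext x
      have hx : x ∈ a ↔ 1 ≤ x ∧ x ≤ a.length := by
        rw [hS.mem_iff, List.mem_range'_1]; omega
      rw [Finset.mem_Icc, ← hx]
      conv_rhs => rw [← hfl]
      simp [LR]
    · rw [omegaP_eq, lrP, him, hok.sort]
      simp [LR, hfl]

/-! ### Monotone relabelling -/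

lemma map_sorted {f : ℕ → ℕ} {w : W} (hw : w.Pairwise (· < ·))
    (hf : ∀ x ∈ w, ∀ y ∈ w, x < y → f x < f y) : (w.map f).Pairwise (· < ·) := by
  rw [List.pairwise_map]
  exact List.Pairwise.imp_of_mem (fun hx hy h => hf _ hx _ hy h) hw

lemma swB_image {f : ℕ → ℕ} {B : Blk} (hf : ∀ x ∈ B, ∀ y ∈ B, x < y → f x < f y) :
    swB (B.image f) = (swB B).map f := by
  have h := map_sorted (f := f) (swB_sorted B)
    (fun x hx y hy => hf x (mem_swB.1 hx) y (mem_swB.1 hy))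
  rw [← swB_toFinset_of_sorted _ h]
  congr 1
  ext x; simp [mem_swB]

lemma headD_map {f : ℕ → ℕ} {u : W} (hu : u ≠ []) : (u.map f).headD 0 = f (u.headD 0) := by
  cases u with
  | nil => exact absurd rfl hu
  | cons a u => simp

lemma omegaP_map {f : ℕ → ℕ} {S : SP} (h : GoodP S)
    (hf : ∀ x ∈ S.biUnion id, ∀ y ∈ S.biUnion id, x < y → f x < f y) :
    omegaP (S.image fun B => B.image f) = (omegaP S).map f := by
  have hm : ∀ w ∈ lrP S, ∀ x ∈ w, x ∈ S.biUnion id := by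
    intro w hw x hx
    obtain ⟨B, hB, rfl⟩ := mem_lrP.1 hw
    exact Finset.mem_biUnion.2 ⟨B, hB, mem_swB.1 hx⟩
  have hok : OKL ((lrP S).map (List.map f)) := by
    constructor
    · intro w hw
      obtain ⟨v, hv, rfl⟩ := List.mem_map.1 hw
      refine ⟨by simpa using (h.okl.1 v hv).1, map_sorted (h.okl.1 v hv).2 ?_⟩
      exact fun x hx y hy => hf x (hm v hv x hx) y (hm v hv y hy)
    · rw [List.pairwise_map]
      refine List.Pairwise.imp_of_mem ?_ h.okl.2
      intro u v hu hv huv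
      have hu' := (h.okl.1 u hu).1
      have hv' := (h.okl.1 v hv).1
      rw [headD_map hu', headD_map hv']
      exact hf _ (hm u hu _ (headD_mem hu')) _ (hm v hv _ (headD_mem hv')) huv
  have heq : lrP (S.image fun B => B.image f) = (lrP S).map (List.map f) := by
    rw [← hok.sort, lrP]
    congr 1
    ext w
    simp only [Finset.mem_image, List.mem_toFinset, List.mem_map, mem_lrP]
    constructor
    · rintro ⟨_, ⟨B, hB, rfl⟩, rfl⟩
      refine ⟨_, ⟨B, hB, rfl⟩, (swB_image ?_).symm⟩
      exact fun x hx y hy => hf x (Finset.mem_biUnion.2 ⟨B, hB, hx⟩) y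
        (Finset.mem_biUnion.2 ⟨B, hB, hy⟩)
    · rintro ⟨_, ⟨B, hB, rfl⟩, rfl⟩
      refine ⟨_, ⟨B, hB, rfl⟩, swB_image ?_⟩
      exact fun x hx y hy => hf x (Finset.mem_biUnion.2 ⟨B, hB, hx⟩) y
        (Finset.mem_biUnion.2 ⟨B, hB, hy⟩)
  rw [omegaP_eq, omegaP_eq, heq, List.map_flatten, List.map_reverse]

/-! ### The product -/

lemma shift_toFinset {σ : SP} (h : GoodP σ) (m : ℕ) :
    (shiftF m (LR (omegaP σ))).toFinset = (shiftP m σ).image swB := by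
  rw [h.LR]
  ext w
  simp only [shiftF, shiftP, List.mem_toFinset, List.mem_map, mem_lrP, Finset.mem_image]
  constructor
  · rintro ⟨_, ⟨B, hB, rfl⟩, rfl⟩
    exact ⟨_, ⟨B, hB, rfl⟩, swB_image (fun x _ y _ h => by simpa using h)⟩
  · rintro ⟨_, ⟨B, hB, rfl⟩, rfl⟩
    exact ⟨_, ⟨B, hB, rfl⟩, (swB_image (fun x _ y _ h => by simpa using h)).symm⟩

/-- `swB` on both components. -/
def swBB (p : Blk × Blk) : W × W := (swB p.1, swB p.2)

lemma swBB_inj : Function.Injective swBB := by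
  rintro ⟨a, b⟩ ⟨c, d⟩ h
  simp only [swBB, Prod.mk.injEq] at h
  rw [swB_inj h.1, swB_inj h.2]

lemma swB_union {B C : Blk} (h : ∀ x ∈ B, ∀ y ∈ C, x < y) :
    swB B ++ swB C = swB (B ∪ C) := by
  have hs : (swB B ++ swB C).Pairwise (· < ·) := by
    rw [List.pairwise_append]
    exact ⟨swB_sorted B, swB_sorted C,
      fun x hx y hy => h x (mem_swB.1 hx) y (mem_swB.1 hy)⟩
  rw [← swB_toFinset_of_sorted _ hs]
  congr 1
  ext x; simp [mem_swB]

lemma Rset_image (π τ : SP) :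
    ((π.image swB ×ˢ τ.image swB).powerset.filter
      (fun Θ : Finset (W × W) => ∀ p ∈ Θ, ∀ q ∈ Θ, (p.1 = q.1 ∨ p.2 = q.2) → p = q)) =
    (RsetP π τ).image (fun Θ => Θ.image swBB) := by
  ext Θ
  simp only [RsetP, Finset.mem_filter, Finset.mem_powerset, Finset.mem_image]
  constructor
  · rintro ⟨hs, hm⟩
    have hs' : Θ ⊆ (π ×ˢ τ).image swBB := by
      intro p hp
      have := hs hp
      simp only [Finset.mem_product, Finset.mem_image] at this
      obtain ⟨⟨B, hB, h1⟩, ⟨C, hC, h2⟩⟩ := this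
      refine Finset.mem_image.2 ⟨(B, C), Finset.mem_product.2 ⟨hB, hC⟩, ?_⟩
      exact Prod.ext h1 h2
    obtain ⟨T, hT, rfl⟩ := Finset.subset_image_iff.1 hs'
    refine ⟨T, ⟨by exact_mod_cast hT, ?_⟩, rfl⟩
    intro p hp q hq hpq
    apply swBB_inj
    refine hm _ (Finset.mem_image_of_mem _ hp) _ (Finset.mem_image_of_mem _ hq) ?_
    rcases hpq with h | h
    · left; simp [swBB, h]
    · right; simp [swBB, h]
  · rintro ⟨T, ⟨hT, hm⟩, rfl⟩
    constructor
    · intro p hp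
      obtain ⟨q, hq, rfl⟩ := Finset.mem_image.1 hp
      have := Finset.mem_product.1 (hT hq)
      exact Finset.mem_product.2 ⟨Finset.mem_image_of_mem _ this.1, Finset.mem_image_of_mem _ this.2⟩
    · intro p hp q hq hpq
      obtain ⟨p', hp', rfl⟩ := Finset.mem_image.1 hp
      obtain ⟨q', hq', rfl⟩ := Finset.mem_image.1 hq
      congr 1
      refine hm p' hp' q' hq' ?_
      rcases hpq with h | h
      · left; exact swB_inj h
      · right; exact swB_inj h

lemma glue_image {π τ : SP} (hlt : ∀ B ∈ π, ∀ C ∈ τ, ∀ x ∈ B, ∀ y ∈ C, x < y)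
    {Θ : Finset (Blk × Blk)} (hΘ : Θ ⊆ π ×ˢ τ) :
    glueSet (π.image swB) (τ.image swB) (Θ.image swBB) = (glueP π τ Θ).image swB := by
  unfold glueSet glueP
  rw [Finset.image_union, Finset.image_union]
  congr 1
  · congr 1
    · rw [Finset.image_image, Finset.image_image]
      apply Finset.image_congr
      intro p hp
      have := Finset.mem_product.1 (hΘ hp)
      exact swB_union (hlt _ this.1 _ this.2)
    · ext w
      simp only [Finset.mem_filter, Finset.mem_image]
      constructor
      · rintro ⟨⟨B, hB, rfl⟩, h⟩
        exact ⟨B, ⟨hB, fun p hp he => h _ ⟨p, hp, rfl⟩ (by simp [swBB, he])⟩, rfl⟩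
      · rintro ⟨B, ⟨hB, h⟩, rfl⟩
        refine ⟨⟨B, hB, rfl⟩, ?_⟩
        rintro _ ⟨p, hp, rfl⟩ he
        exact h p hp (swB_inj he)
  · ext w
    simp only [Finset.mem_filter, Finset.mem_image]
    constructor
    · rintro ⟨⟨B, hB, rfl⟩, h⟩
      exact ⟨B, ⟨hB, fun p hp he => h _ ⟨p, hp, rfl⟩ (by simp [swBB, he])⟩, rfl⟩
    · rintro ⟨B, ⟨hB, h⟩, rfl⟩
      refine ⟨⟨B, hB, rfl⟩, ?_⟩
      rintro _ ⟨p, hp, rfl⟩ he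
      exact h p hp (swB_inj he)

lemma starF_Mb (K : Type) [Field K] (a b : W) :
    starF K (Mb K a) (Mb K b) = mulSingle K a b := by
  unfold starF Mb
  rw [Finsupp.sum_single_index, Finsupp.sum_single_index]
  · simp
  · simp
  · simp

lemma deltaF_Mb (K : Type) [Field K] (a : W) :
    deltaF K (Mb K a) = deltaSingle K a := by
  unfold deltaF Mb
  rw [Finsupp.sum_single_index] <;> simp

lemma part3 (K : Type) [Field K] (m n : ℕ) (π σ : SP) (hπ : IsPartitionOf m π)
    (hσ : IsPartitionOf n σ) :
    starF K (Mb K (omegaP π)) (Mb K (omegaP σ)) =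
        ∑ Θ ∈ RsetP π (shiftP m σ), Mb K (omegaP (glueP π (shiftP m σ) Θ)) := by
  rw [starF_Mb, mulSingle]
  have hlt : ∀ B ∈ π, ∀ C ∈ shiftP m σ, ∀ x ∈ B, ∀ y ∈ C, x < y := by
    intro B hB C hC x hx y hy
    have h1 : x ∈ Finset.Icc 1 m := by
      rw [← hπ.2.2]; exact Finset.mem_biUnion.2 ⟨B, hB, hx⟩
    obtain ⟨D, hD, rfl⟩ := Finset.mem_image.1 hC
    obtain ⟨z, hz, rfl⟩ := Finset.mem_image.1 hy
    have h2 : z ∈ Finset.Icc 1 n := by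
      rw [← hσ.2.2]; exact Finset.mem_biUnion.2 ⟨D, hD, hz⟩
    rw [Finset.mem_Icc] at h1 h2
    show x < z + m
    omega
  have hR : Rset (omegaP π) (omegaP σ) =
      (RsetP π (shiftP m σ)).image (fun Θ => Θ.image swBB) := by
    rw [← Rset_image, Rset, hπ.length, hπ.good.LR_toFinset, shift_toFinset hσ.good]
  rw [hR, Finset.sum_image (fun _ _ _ _ h => Finset.image_injective swBB_inj h)]
  refine Finset.sum_congr rfl fun Θ hΘ => ?_
  congr 1
  rw [mTheta, hπ.length, hπ.good.LR_toFinset, shift_toFinset hσ.good, glue_image hlt]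
  · rfl
  · exact Finset.mem_powerset.1 (Finset.mem_filter.1 hΘ).1

/-! ### The coproduct -/

lemma subWord_omegaP {π S : SP} (h : GoodP π) (hS : S ⊆ π) :
    subWord (omegaP π) (S.image swB) = omegaP S := by
  rw [subWord, wordOf, h.LR, omegaP_eq]
  congr 2
  have hlt : ((lrP π).filter (· ∈ S.image swB)).Pairwise (· < ·) :=
    List.Pairwise.filter _ (Finset.sortedLT_sort _).pairwise
  rw [← sort_toFinset_of_lt _ hlt, lrP]
  congr 1
  ext w
  simp only [List.mem_toFinset, List.mem_filter, mem_lrP, decide_eq_true_eq, Finset.mem_image]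
  constructor
  · rintro ⟨-, h⟩; exact h
  · rintro ⟨B, hB, rfl⟩; exact ⟨mem_lrP.2 ⟨B, hS hB, rfl⟩, ⟨B, hB, rfl⟩⟩

/-- Number of letters of `a` that are at most `x`. -/
def rankW (a : W) (x : ℕ) : ℕ := (a.toFinset.filter (· ≤ x)).card

lemma rankW_eq {a : W} (h : a.Nodup) (i : ℕ) :
    (a.filter (fun x => x ≤ i)).length = rankW a i := by
  rw [rankW, ← List.toFinset_card_of_nodup (h.filter _), List.toFinset_filter]
  simp

lemma rankW_le {a : W} (hp : ∀ x ∈ a, 1 ≤ x) (i : ℕ) : rankW a i ≤ i := by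
  have : a.toFinset.filter (· ≤ i) ⊆ Finset.Icc 1 i := by
    intro x hx
    simp only [Finset.mem_filter, List.mem_toFinset] at hx
    exact Finset.mem_Icc.2 ⟨hp x hx.1, hx.2⟩
  have h := Finset.card_le_card this
  rw [Nat.card_Icc] at h
  unfold rankW
  omega

lemma dVal_spec {a : W} (h : a.Nodup) : rankW a (dVal a) < dVal a := by
  rw [← rankW_eq h]
  exact Nat.find_spec (p := fun i => (a.filter (fun x => x ≤ i)).length < i) _

lemma dVal_min {a : W} (h : a.Nodup) {i : ℕ} (hi : i < dVal a) : i ≤ rankW a i := by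
  rw [← rankW_eq h]
  exact not_lt.1 (Nat.find_min
    (p := fun i => (a.filter (fun x => x ≤ i)).length < i) _ hi)

lemma dVal_le (a : W) : dVal a ≤ a.length + 1 :=
  Nat.find_min' _ (Nat.lt_succ_of_le (List.length_filter_le _ _))

lemma dVal_not_mem {a : W} (h : a.Nodup) : dVal a ∉ a := by
  intro hd
  have h1 := dVal_spec h
  have h2 := dVal_min h (i := dVal a - 1) (by omega)
  have : rankW a (dVal a - 1) < rankW a (dVal a) := by
    apply Finset.card_lt_card
    rw [Finset.ssubset_iff_of_subset]
    · refine ⟨dVal a, by simp [hd], ?_⟩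
      simp; omega
    · intro x hx
      simp only [Finset.mem_filter, List.mem_toFinset] at hx ⊢
      exact ⟨hx.1, by omega⟩
  omega

lemma park_aux (k : ℕ) : ∀ a : W, a.Nodup → (∀ x ∈ a, 1 ≤ x) → a.sum ≤ k →
    parkFuel k a = a.map (rankW a) := by
  induction k with
  | zero =>
    intro a _ hp hs
    cases a with
    | nil => rfl
    | cons x xs =>
      have := hp x (by simp)
      simp at hs; omega
  | succ k ih =>
    intro a hn hp hs
    rw [parkFuel]
    split_ifs with hd
    · conv_lhs => rw [← List.map_id a]
      apply List.map_congr_left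
      intro x hx
      have hc : a.toFinset.card = a.length := List.toFinset_card_of_nodup hn
      have h1 := dVal_min hn (i := a.length) (by omega)
      have hall : a.toFinset.filter (· ≤ a.length) = a.toFinset :=
        Finset.eq_of_subset_of_card_le (Finset.filter_subset _ _) (by rw [hc]; exact h1)
      have hxl : x ≤ a.length := by
        have : x ∈ a.toFinset.filter (· ≤ a.length) := by rw [hall]; simpa using hx
        exact (Finset.mem_filter.1 this).2
      exact le_antisymm (dVal_min hn (by rw [hd, id]; omega)) (rankW_le hp x)
    · set g : ℕ → ℕ := fun x => if dVal a < x then x - 1 else x with hg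
      have hdn := dVal_not_mem hn
      have hspec := dVal_spec hn
      have hmono : ∀ x ∈ a, ∀ y ∈ a, (g x ≤ g y ↔ x ≤ y) := by
        intro x hx y hy
        have h1 : x ≠ dVal a := fun h => hdn (h ▸ hx)
        have h2 : y ≠ dVal a := fun h => hdn (h ▸ hy)
        simp only [hg]
        split_ifs <;> omega
      have hinj : ∀ x ∈ a, ∀ y ∈ a, g x = g y → x = y := by
        intro x hx y hy h
        exact le_antisymm ((hmono x hx y hy).1 h.le) ((hmono y hy x hx).1 h.ge)
      have hps : parkStep a = a.map g := rfl
      have hsum : (a.map g).sum < a.sum := by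
        have hex : ∃ x ∈ a, dVal a < x := by
          by_contra! hcon
          have hall : a.toFinset.filter (· ≤ dVal a) = a.toFinset := by
            apply Finset.filter_true_of_mem
            intro x hx; exact hcon x (by simpa using hx)
          have hc : a.toFinset.card = a.length := List.toFinset_card_of_nodup hn
          have := dVal_le a
          rw [rankW, hall, hc] at hspec
          omega
        obtain ⟨x, hx, hdx⟩ := hex
        have := List.sum_lt_sum (l := a) g id
          (fun y _ => by simp only [hg, id]; split_ifs <;> omega)
          ⟨x, hx, by simp only [hg, id, if_pos hdx]; omega⟩
        simpa using this
      rw [hps, ih (a.map g) (hn.map_on (fun x hx y hy h => hinj x hx y hy h)) ?_ (by omega), List.map_map]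
      · apply List.map_congr_left
        intro x hx
        simp only [Function.comp, rankW]
        have : (a.map g).toFinset.filter (· ≤ g x) = (a.toFinset.filter (· ≤ x)).image g := by
          ext z
          simp only [Finset.mem_filter, List.mem_toFinset, List.mem_map, Finset.mem_image]
          constructor
          · rintro ⟨⟨y, hy, rfl⟩, hz⟩
            exact ⟨y, ⟨hy, (hmono y hy x hx).1 hz⟩, rfl⟩
          · rintro ⟨y, ⟨hy, hz⟩, rfl⟩
            exact ⟨⟨y, hy, rfl⟩, (hmono y hy x hx).2 hz⟩
        rw [this, Finset.card_image_of_injOn]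
        intro y hy z hz h
        simp only [Finset.coe_filter, List.mem_toFinset, Set.mem_setOf_eq] at hy hz
        exact hinj y hy.1 z hz.1 h
      · intro z hz
        obtain ⟨y, hy, rfl⟩ := List.mem_map.1 hz
        have := hp y hy
        simp only [hg]
        split_ifs <;> omega

lemma park_omegaP {S : SP} (h : GoodP S) (hp : ∀ x ∈ S.biUnion id, 1 ≤ x) :
    Park (omegaP S) = omegaP (stP S) := by
  rw [Park, park_aux _ _ h.nodup (fun x hx => hp x (by
    rw [← omegaP_toFinset]; simpa using hx)) le_rfl, stP, omegaP_map h]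
  · apply List.map_congr_left
    intro x _
    rw [rankW, omegaP_toFinset]
  · intro x hx y hy hxy
    apply Finset.card_lt_card
    rw [Finset.ssubset_iff_of_subset]
    · refine ⟨y, Finset.mem_filter.2 ⟨hy, le_rfl⟩, ?_⟩
      rw [Finset.mem_filter]; omega
    · intro z hz
      rw [Finset.mem_filter] at hz ⊢
      exact ⟨hz.1, by omega⟩

lemma part4 (K : Type) [Field K] (n : ℕ) (π : SP) (hπ : IsPartitionOf n π) :
    deltaF K (Mb K (omegaP π)) =
        ∑ S ∈ π.powerset,
          Finsupp.single (omegaP (stP S), omegaP (stP (π \ S))) (1 : K) := by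
  have hpos : ∀ S ⊆ π, ∀ x ∈ S.biUnion id, 1 ≤ x := by
    intro S hS x hx
    have : x ∈ π.biUnion id := Finset.biUnion_subset_biUnion_of_subset_left _ hS hx
    rw [hπ.2.2, Finset.mem_Icc] at this
    exact this.1
  have hpw : (π.image swB).powerset = π.powerset.image (fun S => S.image swB) := by
    ext T
    simp only [Finset.mem_powerset, Finset.mem_image]
    constructor
    · intro h
      obtain ⟨S, hS, rfl⟩ := Finset.subset_image_iff.1 h
      exact ⟨S, by exact_mod_cast hS, rfl⟩
    · rintro ⟨S, hS, rfl⟩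
      exact Finset.image_subset_image hS
  rw [deltaF_Mb, deltaSingle, hπ.good.LR_toFinset, hpw,
    Finset.sum_image (fun _ _ _ _ h => Finset.image_injective swB_inj h)]
  refine Finset.sum_congr rfl fun S hS => ?_
  have hS' := Finset.mem_powerset.1 hS
  have hc : π \ S ⊆ π := Finset.sdiff_subset
  rw [← Finset.image_sdiff _ _ swB_inj, subWord_omegaP hπ.good hS', subWord_omegaP hπ.good hc,
    park_omegaP (hπ.good.subset hS') (hpos S hS'), park_omegaP (hπ.good.subset hc) (hpos _ hc)]

/-- For each `n`, `ω : Π_n → Π̃_n = N_n ∩ S_n` is a bijection,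
and the linear map `NCSym → KΠ̃` determined by `M_π ↦ M_{ω(π)}` is an
isomorphism of algebras and coalgebras — it is injective on basis elements,
it intertwines the product of `NCSym` (given by matchings of blocks) with `⋆`,
it intertwines the coproduct of `NCSym` (given by standardized splittings)
with `Δ`, and it carries the span of the `M_π` onto `KΠ̃ ⊆ PFSym`. -/
theorem stmt18 (K : Type) [Field K] [CharZero K] :
    (∀ n : ℕ, Set.BijOn omegaP {π : SP | IsPartitionOf n π}
      {a : W | IsPF a ∧ a.length = n ∧ Nprop a ∧ Sprop a}) ∧
    (Function.Injective
      (fun π : {π : SP // ∃ n, IsPartitionOf n π} => omegaP π.1)) ∧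
    (∀ m n : ℕ, ∀ π σ : SP, IsPartitionOf m π → IsPartitionOf n σ →
      starF K (Mb K (omegaP π)) (Mb K (omegaP σ)) =
        ∑ Θ ∈ RsetP π (shiftP m σ), Mb K (omegaP (glueP π (shiftP m σ) Θ))) ∧
    (∀ n : ℕ, ∀ π : SP, IsPartitionOf n π →
      deltaF K (Mb K (omegaP π)) =
        ∑ S ∈ π.powerset,
          Finsupp.single (omegaP (stP S), omegaP (stP (π \ S))) (1 : K)) ∧
    (Submodule.span K
        (Set.range (fun π : {π : SP // ∃ n, IsPartitionOf n π} =>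
          Mb K (omegaP π.1))) =
      Submodule.span K {z : FW K | ∃ a : W,
        (IsPF a ∧ Nprop a ∧ Sprop a) ∧ z = Mb K a}) := by
  refine ⟨part1, ?_, part3 K, part4 K, ?_⟩
  · rintro ⟨π, m, hπ⟩ ⟨σ, n, hσ⟩ h
    exact Subtype.ext (hπ.good.inj hσ.good h)
  · congr 1
    ext z
    constructor
    · rintro ⟨⟨π, n, hπ⟩, rfl⟩
      obtain ⟨h1, -, h2, h3⟩ := (part1 n).mapsTo hπ
      exact ⟨_, ⟨h1, h2, h3⟩, rfl⟩
    · rintro ⟨a, ⟨h1, h2, h3⟩, rfl⟩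
      obtain ⟨π, hπ, rfl⟩ := (part1 a.length).surjOn ⟨h1, rfl, h2, h3⟩
      exact ⟨⟨π, _, hπ⟩, rfl⟩
end

section
/- For n ≥ 1, the set of atomic nonincreasing parking functions of length n equals { u·1 : u ∈ C_{n−1} } (the words obtained by appending the letter 1 to a nonincreasing parking function of length n−1); consequently, |C_n| equals the n-th Catalan number and the number of atomic elements of C_n equals the (n−1)-st Catalan number. -/
open scoped Classical

def DD : W → Prop
  | [] => True
  | x :: xs => 1 ≤ x ∧ x ≤ xs.length + 1 ∧ (∀ y ∈ xs, y ≤ x) ∧ DD xs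

theorem nonInc_iff (a : W) : NonInc a ↔ a.Pairwise (fun x y => y ≤ x) := by
  unfold NonInc
  haveI : IsTrans ℕ (fun x y => y ≤ x) := ⟨fun _ _ _ h1 h2 => le_trans h2 h1⟩
  exact List.isChain_iff_pairwise

theorem sort_eq (a : W) (h : a.Pairwise (fun x y => y ≤ x)) :
    a.insertionSort (· ≤ ·) = a.reverse := by
  have h1 : (a.insertionSort (· ≤ ·)).Pairwise (· ≤ ·) := List.pairwise_insertionSort _ _
  have h2 : a.reverse.Pairwise (· ≤ ·) := List.pairwise_reverse.2 h
  exact ((List.perm_insertionSort (· ≤ ·) a).trans a.reverse_perm.symm).eq_of_pairwise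
    (fun _ _ _ _ h1 h2 => le_antisymm h1 h2) h1 h2

theorem DD_iff_aux (a : W) : DD a ↔ a.Pairwise (fun x y => y ≤ x) ∧ (∀ x ∈ a, 1 ≤ x) ∧
    ∀ i, i < a.length → a.reverse.getD i 0 ≤ i + 1 := by
  induction a with
  | nil => simp [DD]
  | cons x xs ih =>
    rw [DD, ih, List.pairwise_cons]
    constructor
    · rintro ⟨h1, h2, h3, h4, h5, h6⟩
      refine ⟨⟨h3, h4⟩, by simpa using ⟨h1, h5⟩, ?_⟩
      intro i hi
      rw [List.reverse_cons]
      rcases Nat.lt_or_ge i xs.length with h | h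
      · rw [List.getD_append _ _ _ _ (by simpa using h)]
        exact h6 i h
      · have : i = xs.length := by simp at hi; omega
        subst this
        rw [List.getD_append_right _ _ _ _ (by simp)]
        simpa using h2
    · rintro ⟨⟨h3, h4⟩, h5, h6⟩
      simp only [List.mem_cons, forall_eq_or_imp] at h5
      refine ⟨h5.1, ?_, h3, h4, h5.2, ?_⟩
      · have := h6 xs.length (by simp)
        rw [List.reverse_cons, List.getD_append_right _ _ _ _ (by simp)] at this
        simpa using this
      · intro i hi
        have := h6 i (by simp; omega)
        rwa [List.reverse_cons, List.getD_append _ _ _ _ (by simpa using hi)] at this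

theorem DD_iff (a : W) : DD a ↔ IsPF a ∧ NonInc a := by
  rw [DD_iff_aux, nonInc_iff, IsPF]
  constructor
  · rintro ⟨h1, h2, h3⟩
    rw [sort_eq a h1]
    exact ⟨⟨h2, h3⟩, h1⟩
  · rintro ⟨⟨h2, h3⟩, h1⟩
    rw [sort_eq a h1] at h3
    exact ⟨h1, h2, h3⟩

theorem DD_right (p s : W) (h : DD (p ++ s)) : DD s := by
  induction p with
  | nil => exact h
  | cons x xs ih => exact ih h.2.2.2

theorem DD_pos (a : W) (h : DD a) : ∀ x ∈ a, 1 ≤ x := ((DD_iff_aux a).1 h).2.1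

theorem DD_le (a : W) (h : DD a) : ∀ x ∈ a, x ≤ a.length := by
  induction a with
  | nil => simp
  | cons y ys ih =>
    intro x hx
    rcases List.mem_cons.1 hx with rfl | hx
    · simpa using h.2.1
    · have := ih h.2.2.2 x hx
      simp; omega

theorem DD_last (a : W) (h : DD a) (hne : a ≠ []) : ∃ p, a = p ++ [1] := by
  obtain ⟨p, x, rfl⟩ := List.eq_nil_or_concat'  a |>.resolve_left hne
  have := DD_right _ _ h
  simp [DD] at this
  exact ⟨p, by rw [show x = 1 by omega]⟩

theorem DD_append_one (u : W) (h : DD u) : DD (u ++ [1]) := by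
  induction u with
  | nil => simp [DD]
  | cons x xs ih =>
    obtain ⟨h1, h2, h3, h4⟩ := h
    refine ⟨h1, by simp; omega, ?_, ih h4⟩
    intro y hy
    rcases List.mem_append.1 hy with hy | hy
    · exact h3 y hy
    · simp at hy; omega

theorem DD_slash (b c : W) (hb : DD b) (hc : DD c) : DD (slashProd b c) := by
  unfold slashProd shiftW
  induction c with
  | nil => simpa using hb
  | cons x xs ih =>
    obtain ⟨h1, h2, h3, h4⟩ := hc
    refine ⟨by simp only []; omega, by simp; omega, ?_, ih h4⟩
    intro y hy
    rcases List.mem_append.1 hy with hy | hy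
    · obtain ⟨z, hz, rfl⟩ := List.mem_map.1 hy
      have := h3 z hz
      simp only []; omega
    · have := DD_le b hb y hy
      simp only []; omega

theorem decomp (a : W) (h : DD a) (hne : a ≠ []) :
    ∃ u c, DD u ∧ DD c ∧ a = slashProd (u ++ [1]) c := by
  induction a with
  | nil => exact absurd rfl hne
  | cons x xs ih =>
    obtain ⟨h1, h2, h3, h4⟩ := h
    by_cases hx : xs = []
    · subst hx
      refine ⟨[], [], trivial, trivial, ?_⟩
      simp at h2
      simp [slashProd, shiftW]; omega
    · obtain ⟨u, c, hu, hc, rfl⟩ := ih h4 hx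
      rcases c with _ | ⟨y, ys⟩
      · simp only [slashProd, shiftW, List.map_nil, List.nil_append] at *
        by_cases hxu : x ≤ u.length + 1
        · exact ⟨x :: u, [], ⟨h1, hxu, fun y hy => h3 y (by simp [hy]), hu⟩, trivial, by simp⟩
        · refine ⟨u, [1], hu, by simp [DD], ?_⟩
          simp at h2 ⊢; omega
      · refine ⟨u, (x - (u.length + 1)) :: y :: ys, hu, ⟨?_, ?_, ?_, hc⟩, ?_⟩
        · have := h3 (y + (u.length + 1)) (by simp [slashProd, shiftW])
          have := hc.1
          omega
        · simp [slashProd, shiftW] at h2 ⊢; omega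
        · intro z hz
          have := h3 (z + (u.length + 1)) (by
            simp only [slashProd, shiftW, List.mem_append, List.mem_map]
            left; exact ⟨z, hz, by simp⟩)
          omega
        · have := h3 (y + (u.length + 1)) (by simp [slashProd, shiftW])
          simp [slashProd, shiftW]; omega

/-- The key uniqueness fact. -/
theorem key (u b c p : W) (hu : DD u) (hc : DD c) (hcn : c ≠ []) (hbn : b = p ++ [1])
    (q : W) (h : q ++ (u ++ [1]) = slashProd b c) : u.length + 1 ≤ b.length := by
  by_contra hlt
  subst hbn
  obtain ⟨r, rfl⟩ := DD_last c hc hcn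
  simp only [slashProd, shiftW, List.map_append, List.map_cons, List.map_nil,
    ← List.append_assoc, List.append_cancel_right_eq] at h
  simp only [List.length_append, List.length_cons, List.length_nil] at h hlt
  have hs : ((1 + (p.length + (0 + 1))) :: p) <:+ u := by
    refine List.suffix_of_suffix_length_le (l₃ := q ++ u) ?_ (List.suffix_append _ _) (by simp; omega)
    rw [h]
    exact ⟨List.map (fun x => x + (p.length + (0 + 1))) r, by simp⟩
  obtain ⟨t, rfl⟩ := hs
  have := (DD_right _ _ hu).2.1
  omega

theorem shift_inj (m : ℕ) (c c' : W) (h : shiftW m c = shiftW m c') : c = c' :=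
  List.map_injective_iff.2 (add_left_injective m) h

theorem decomp_unique (u c u' c' : W) (hu : DD u) (hc : DD c) (hu' : DD u') (hc' : DD c')
    (h : slashProd (u ++ [1]) c = slashProd (u' ++ [1]) c') : u = u' ∧ c = c' := by
  have aux : ∀ u c u' c' : W, DD u → DD c → DD u' → DD c' →
      slashProd (u ++ [1]) c = slashProd (u' ++ [1]) c' → u.length ≤ u'.length := by
    intro u c u' c' hu hc hu' hc' h
    by_cases hn : c' = []
    · have := congrArg List.length h
      subst hn
      simp [slashProd, shiftW] at this
      omega
    · have := key u (u' ++ [1]) c' u' hu hc' hn rfl _ h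
      simpa using this
  have hl := le_antisymm (aux _ _ _ _ hu hc hu' hc' h) (aux _ _ _ _ hu' hc' hu hc h.symm)
  obtain ⟨h1, h2⟩ := List.append_inj' h (by simp [hl])
  have h2' := (List.append_inj' h2 rfl).1
  subst h2'
  exact ⟨rfl, shift_inj _ _ _ h1⟩

theorem split_DD (b c : W) (hb : IsPF b) (hc : IsPF c) (h : NonInc (slashProd b c)) :
    DD b ∧ DD c := by
  rw [nonInc_iff, slashProd, shiftW, List.pairwise_append, List.pairwise_map] at h
  rw [DD_iff, DD_iff, nonInc_iff, nonInc_iff]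
  exact ⟨⟨hb, h.2.1⟩, hc, by simpa using h.1⟩

theorem atomic_iff (a : W) : (NonInc a ∧ AtomicPF a) ↔ ∃ u, DD u ∧ a = u ++ [1] := by
  constructor
  · rintro ⟨hn, hp, hne, hat⟩
    obtain ⟨u, c, hu, hc, rfl⟩ := decomp a ((DD_iff a).2 ⟨hp, hn⟩) hne
    by_cases hcn : c = []
    · subst hcn
      exact ⟨u, hu, by simp [slashProd, shiftW]⟩
    · exact absurd ⟨u ++ [1], c, ((DD_iff _).1 (DD_append_one u hu)).1, ((DD_iff _).1 hc).1,
        by simp, hcn, rfl⟩ hat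
  · rintro ⟨u, hu, rfl⟩
    have h := (DD_iff _).1 (DD_append_one u hu)
    refine ⟨h.2, h.1, by simp, ?_⟩
    rintro ⟨b, c, hb, hc, hbn, hcn, heq⟩
    obtain ⟨hb', hc'⟩ := split_DD b c hb hc (heq ▸ h.2)
    obtain ⟨p, hp⟩ := DD_last b hb' hbn
    have h1 := key u b c p hu hc' hcn hp [] heq
    have h2 := congrArg List.length heq
    have h3 := List.length_pos_of_ne_nil hcn
    simp [slashProd, shiftW] at h2
    omega

theorem mem_C (n : ℕ) (a : W) : a ∈ (pfFinset n).filter NonInc ↔ DD a ∧ a.length = n := by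
  rw [Finset.mem_filter, pfFinset, Finset.mem_filter, DD_iff]
  constructor
  · rintro ⟨⟨h1, h2⟩, h3⟩
    obtain ⟨f, -, rfl⟩ := Finset.mem_image.1 h1
    exact ⟨⟨h2, h3⟩, by simp⟩
  · rintro ⟨⟨h2, h3⟩, rfl⟩
    have hD := (DD_iff a).2 ⟨h2, h3⟩
    refine ⟨⟨Finset.mem_image.2 ⟨fun i => ⟨a.get i - 1, ?_⟩, Finset.mem_univ _, ?_⟩, h2⟩, h3⟩
    · have := DD_le a hD _ (List.get_mem a i)
      have := DD_pos a hD _ (List.get_mem a i)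
      omega
    · conv_rhs => rw [← List.ofFn_get a]
      congr 1
      funext i
      have := DD_pos a hD _ (List.get_mem a i)
      simp only []; omega

def treeW : BinaryTree Unit → W
  | .nil => []
  | .node _ l r => slashProd (treeW l ++ [1]) (treeW r)

theorem treeW_DD (t : BinaryTree Unit) : DD (treeW t) ∧ (treeW t).length = t.numNodes := by
  induction t with
  | nil => exact ⟨trivial, rfl⟩
  | node _ l r hl hr =>
    refine ⟨DD_slash _ _ (DD_append_one _ hl.1) hr.1, ?_⟩
    simp [treeW, slashProd, shiftW, hl.2, hr.2, BinaryTree.numNodes]; omega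

theorem treeW_inj (t t' : BinaryTree Unit) (h : treeW t = treeW t') : t = t' := by
  induction t generalizing t' with
  | nil =>
    cases t' with
    | nil => rfl
    | node _ l r => simp [treeW, slashProd] at h
  | node _ l r hl hr =>
    cases t' with
    | nil => simp [treeW, slashProd] at h
    | node _ l' r' =>
      have := decomp_unique _ _ _ _ (treeW_DD l).1 (treeW_DD r).1 (treeW_DD l').1 (treeW_DD r').1 h
      rw [hl _ this.1, hr _ this.2]

theorem treeW_surj (n : ℕ) : ∀ a : W, a.length = n → DD a → ∃ t, treeW t = a := by
  induction n using Nat.strong_induction_on with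
  | _ n ih =>
    intro a hl ha
    by_cases hne : a = []
    · exact ⟨.nil, hne.symm⟩
    · obtain ⟨u, c, hu, hc, rfl⟩ := decomp a ha hne
      simp [slashProd, shiftW] at hl
      obtain ⟨l, rfl⟩ := ih u.length (by omega) u rfl hu
      obtain ⟨r, rfl⟩ := ih c.length (by omega) c rfl hc
      exact ⟨.node () l r, rfl⟩

theorem card_C (n : ℕ) :
    ((pfFinset n).filter NonInc).card = Nat.choose (2 * n) n / (n + 1) := by
  rw [← Nat.centralBinom_eq_two_mul_choose, ← catalan_eq_centralBinom_div,
    ← BinaryTree.treesOfNumNodesEq_card_eq_catalan]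
  symm
  refine Finset.card_bij (fun t _ => treeW t) ?_ ?_ ?_
  · intro t ht
    rw [BinaryTree.mem_treesOfNumNodesEq] at ht
    rw [mem_C]
    exact ⟨(treeW_DD t).1, (treeW_DD t).2.trans ht⟩
  · intro t _ t' _ h
    exact treeW_inj t t' h
  · intro a ha
    rw [mem_C] at ha
    obtain ⟨t, rfl⟩ := treeW_surj n a ha.2 ha.1
    exact ⟨t, by rw [BinaryTree.mem_treesOfNumNodesEq, ← ha.2, (treeW_DD t).2], rfl⟩

/-- For `n ≥ 1`, the atomic nonincreasing parking functions of
length `n` are exactly the words `u ⬝ 1` with `u` a nonincreasing parking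
function of length `n - 1`; consequently `|C_n|` is the `n`-th Catalan number
`C(2n, n)/(n+1)` and the number of atomic elements of `C_n` is the `(n-1)`-st
Catalan number. -/
theorem stmt19 (n : ℕ) (hn : 1 ≤ n) :
    {a : W | IsPF a ∧ a.length = n ∧ NonInc a ∧ AtomicPF a} =
      {a : W | ∃ u : W, IsPF u ∧ NonInc u ∧ u.length = n - 1 ∧ a = u ++ [1]} ∧
    ((pfFinset n).filter NonInc).card = Nat.choose (2 * n) n / (n + 1) ∧
    ((pfFinset n).filter (fun a => NonInc a ∧ AtomicPF a)).card =
      Nat.choose (2 * (n - 1)) (n - 1) / (n - 1 + 1) := by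
  refine ⟨?_, card_C n, ?_⟩
  · ext a
    simp only [Set.mem_ofPred_eq]
    constructor
    · rintro ⟨h1, h2, h3⟩
      obtain ⟨u, hu, rfl⟩ := (atomic_iff a).1 h3
      simp at h2
      exact ⟨u, ((DD_iff u).1 hu).1, ((DD_iff u).1 hu).2, by omega, rfl⟩
    · rintro ⟨u, h1, h2, h3, rfl⟩
      have hu := (DD_iff u).2 ⟨h1, h2⟩
      have h := (atomic_iff (u ++ [1])).2 ⟨u, hu, rfl⟩
      exact ⟨h.2.1, by simp; omega, h⟩
  · rw [← card_C (n - 1)]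
    symm
    refine Finset.card_bij (fun u _ => u ++ [1]) ?_ ?_ ?_
    · intro u hu
      rw [mem_C] at hu
      have h := (atomic_iff (u ++ [1])).2 ⟨u, hu.1, rfl⟩
      have h' := (mem_C n (u ++ [1])).2 ⟨DD_append_one u hu.1, by simp; omega⟩
      exact Finset.mem_filter.2 ⟨(Finset.mem_filter.1 h').1, h⟩
    · intro u _ u' _ h
      exact List.append_cancel_right h
    · intro a ha
      rw [Finset.mem_filter] at ha
      have h' := (mem_C n a).1 (Finset.mem_filter.2 ⟨ha.1, ha.2.1⟩)
      obtain ⟨u, hu, rfl⟩ := (atomic_iff a).1 ha.2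
      refine ⟨u, (mem_C _ _).2 ⟨hu, ?_⟩, rfl⟩
      have := h'.2
      simp at this
      omega
end
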